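/- Let a_1, b_1, c_1, d_1, a_2, b_2, c_2, d_2 be integers such that every 2x2 minor of the 2x4 matrix [[a_1, b_1, c_1, d_1],[a_2, b_2, c_2, d_2]] is nonzero (i.e., a_1*b_2 - a_2*b_1, a_1*c_2 - a_2*c_1, a_1*d_2 - a_2*d_1, b_1*c_2 - b_2*c_1, b_1*d_2 - b_2*d_1, and c_1*d_2 - c_2*d_1 are all nonzero). Then the set of integer triples (x,y,z) satisfying both a_1*x^2 + b_1*y^2 + c_1*z^2 = d_1 and a_2*x^2 + b_2*y^2 + c_2*z^2 = d_2 is finite. -/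

import Mathlib

open Polynomial

theorem X_sub_C_pow_dvd_iff_hasseDeriv_eval_eq_zero {R : Type*} [CommRing R] {f : R[X]} {a : R}
    {n : ℕ} : (X - C a) ^ n ∣ f ↔ ∀ j < n, (hasseDeriv j f).eval a = 0 := by
  rw [X_sub_C_pow_dvd_iff, ← taylor_apply, X_pow_dvd_iff]
  simp only [taylor_coeff]

/-- If `P - c Q` vanishes to order `n + 1` at `a`, then the Wronskian of `P` and `Q` vanishes
to order `n` there. -/
theorem X_sub_C_pow_dvd_wronskian {R : Type*} [CommRing R] {P Q : R[X]} {a c : R} {n : ℕ}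
    (h : (X - C a) ^ (n + 1) ∣ P - C c * Q) : (X - C a) ^ n ∣ wronskian P Q := by
  have hW : wronskian P Q = wronskian (P - C c * Q) Q := by
    simp only [wronskian, derivative_sub, derivative_mul, derivative_C]
    ring
  obtain ⟨S, hS⟩ := h
  have hd : (X - C a) ^ n ∣ derivative (P - C c * Q) := by
    rw [hS, derivative_mul, derivative_pow, pow_succ]
    refine dvd_add ?_ ?_
    · simp only [Nat.add_sub_cancel]
      exact ((dvd_mul_left _ _).mul_right _).mul_right _
    · exact (dvd_mul_right _ _).mul_right _
  rw [hW, wronskian]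
  refine dvd_sub ?_ (hd.mul_right _)
  rw [hS, pow_succ]
  exact ((dvd_mul_right _ _).mul_right _).mul_right _

theorem wronskian_mul_mul {R : Type*} [CommRing R] (g P Q : R[X]) :
    wronskian (g * P) (g * Q) = g ^ 2 * wronskian P Q := by
  simp only [wronskian, derivative_mul]
  ring

theorem natDegree_wronskian_le {R : Type*} [CommRing R] {P Q : R[X]} {m : ℕ}
    (hP : P.natDegree ≤ m) (hQ : Q.natDegree ≤ m) : (wronskian P Q).natDegree ≤ 2 * m := by
  by_cases hW : wronskian P Q = 0
  · simp [hW]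
  · have := natDegree_wronskian_lt_add hW
    omega

/-- A rational polynomial vanishing to order `n` at `α` is divisible by the `n`-th power of the
minimal polynomial of `α`. -/
theorem minpoly_pow_dvd_of_X_sub_C_pow_dvd {α : ℝ} (hα : IsIntegral ℚ α) {n : ℕ} {g : ℚ[X]}
    (h : (X - C α) ^ n ∣ g.map (algebraMap ℚ ℝ)) : minpoly ℚ α ^ n ∣ g := by
  induction n generalizing g with
  | zero => simp
  | succ n ih =>
    have h0 : aeval α g = 0 := by
      rw [aeval_def, ← eval_map, ← IsRoot.def, ← dvd_iff_isRoot]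
      exact (dvd_pow_self _ n.succ_ne_zero).trans h
    obtain ⟨g', rfl⟩ := minpoly.dvd ℚ α h0
    obtain ⟨f, hf⟩ : X - C α ∣ (minpoly ℚ α).map (algebraMap ℚ ℝ) := by
      rw [dvd_iff_isRoot, IsRoot.def, eval_map, ← aeval_def, minpoly.aeval]
    have hfα : ¬ X - C α ∣ f := by
      rintro ⟨f', rfl⟩
      have hs : ((minpoly ℚ α).map (algebraMap ℚ ℝ)).Separable :=
        (minpoly.irreducible hα).separable.map
      rw [hf] at hs
      exact not_isUnit_X_sub_C α (hs.squarefree (X - C α) ⟨f', by ring⟩)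
    rw [pow_succ']
    refine mul_dvd_mul_left _ (ih ?_)
    rw [Polynomial.map_mul, hf, pow_succ', mul_assoc] at h
    have h' := (mul_dvd_mul_iff_left (X_sub_C_ne_zero α)).1 h
    exact (prime_X_sub_C α).pow_dvd_of_dvd_mul_left n hfα h'

theorem wronskian_ne_zero_of_X_sub_C_pow_dvd {α : ℝ} {n m : ℕ}
    (hdeg : 2 ≤ (minpoly ℚ α).natDegree) (hm : m < (minpoly ℚ α).natDegree * n) {P Q : ℚ[X]}
    (hPQ : P ≠ 0 ∨ Q ≠ 0) (hP : P.natDegree ≤ m) (hQ : Q.natDegree ≤ m)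
    (h : (X - C α) ^ n ∣ P.map (algebraMap ℚ ℝ) - C α * Q.map (algebraMap ℚ ℝ)) :
    wronskian P Q ≠ 0 := by
  classical
  intro hW
  have hα : IsIntegral ℚ α := by
    by_contra hα
    simp [minpoly.eq_zero hα] at hdeg
  have hirr : ∀ r : ℚ, (r : ℝ) ≠ α := by
    rintro r rfl
    have : minpoly ℚ (r : ℝ) = X - C r := minpoly.eq_X_sub_C ℝ r
    simp [this] at hdeg
  set g := EuclideanDomain.gcd P Q with hg
  have hg0 : g ≠ 0 := by
    intro h0
    rw [hg, EuclideanDomain.gcd_eq_zero_iff] at h0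
    tauto
  obtain ⟨P₁, hP₁⟩ := EuclideanDomain.gcd_dvd_left P Q
  obtain ⟨Q₁, hQ₁⟩ := EuclideanDomain.gcd_dvd_right P Q
  rw [← hg] at hP₁ hQ₁
  have hcop : IsCoprime P₁ Q₁ := by
    have hb := EuclideanDomain.gcd_eq_gcd_ab P Q
    refine ⟨EuclideanDomain.gcdA P Q, EuclideanDomain.gcdB P Q, mul_left_cancel₀ hg0 ?_⟩
    rw [← hg] at hb
    calc _ = (g * P₁) * EuclideanDomain.gcdA P Q + (g * Q₁) * EuclideanDomain.gcdB P Q := by ring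
      _ = g := by rw [← hP₁, ← hQ₁]; exact hb.symm
      _ = g * 1 := by ring
  have hW₁ : wronskian P₁ Q₁ = 0 := by
    have := wronskian_mul_mul g P₁ Q₁
    rw [← hP₁, ← hQ₁, hW] at this
    have h2 := pow_ne_zero 2 hg0
    simpa [h2] using this.symm
  obtain ⟨hdP, hdQ⟩ := hcop.wronskian_eq_zero_iff.1 hW₁
  have hPc := eq_C_of_derivative_eq_zero hdP
  have hQc := eq_C_of_derivative_eq_zero hdQ
  set p := P₁.coeff 0
  set q := Q₁.coeff 0
  have hpq : ((p : ℝ) - α * q) ≠ 0 := by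
    intro h0
    by_cases hq : q = 0
    · have hp : p = 0 := by simpa [hq] using h0
      rw [hPc, hQc, hp, hq, C_0] at hcop
      exact not_isCoprime_zero_zero hcop
    · refine hirr (p / q) ?_
      have : (q : ℝ) ≠ 0 := by exact_mod_cast hq
      push_cast
      field_simp
      linarith
  have hgd : (X - C α) ^ n ∣ g.map (algebraMap ℚ ℝ) := by
    have he : P.map (algebraMap ℚ ℝ) - C α * Q.map (algebraMap ℚ ℝ) =
        C ((p : ℝ) - α * q) * g.map (algebraMap ℚ ℝ) := by
      rw [hP₁, hQ₁, hPc, hQc]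
      simp
      ring
    rw [he] at h
    exact (Polynomial.dvd_C_mul hpq).1 h
  have hle := natDegree_le_of_dvd (minpoly_pow_dvd_of_X_sub_C_pow_dvd hα hgd) hg0
  rw [natDegree_pow] at hle
  have hgm : g.natDegree ≤ m := by
    rcases hPQ with h0 | h0
    · exact (natDegree_le_of_dvd ⟨_, hP₁⟩ h0).trans hP
    · exact (natDegree_le_of_dvd ⟨_, hQ₁⟩ h0).trans hQ
  rw [mul_comm] at hm
  omega

/-- Nonvanishing at rational points of a derivative of small order of the auxiliary form
`P(x) - y Q(x)`. -/
theorem exists_hasseDeriv_eval_ne {α : ℝ} {n m J : ℕ}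
    (hdeg : 2 ≤ (minpoly ℚ α).natDegree) (hm : m < (minpoly ℚ α).natDegree * (n + 1))
    (hJ : 2 * m < (minpoly ℚ α).natDegree * n + J) {P Q : ℚ[X]}
    (hPQ : P ≠ 0 ∨ Q ≠ 0) (hP : P.natDegree ≤ m) (hQ : Q.natDegree ≤ m)
    (h : (X - C α) ^ (n + 1) ∣ P.map (algebraMap ℚ ℝ) - C α * Q.map (algebraMap ℚ ℝ)) (r s : ℚ) :
    ∃ j ≤ J, (hasseDeriv j P).eval r ≠ s * (hasseDeriv j Q).eval r := by
  by_contra! hj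
  have hα : IsIntegral ℚ α := by
    by_contra hα
    simp [minpoly.eq_zero hα] at hdeg
  have hW := wronskian_ne_zero_of_X_sub_C_pow_dvd hdeg hm hPQ hP hQ h
  have h1 : minpoly ℚ α ^ n ∣ wronskian P Q := by
    refine minpoly_pow_dvd_of_X_sub_C_pow_dvd hα ?_
    have := X_sub_C_pow_dvd_wronskian h
    simpa [wronskian, derivative_map] using this
  have h2 : (X - C r) ^ J ∣ wronskian P Q := by
    refine X_sub_C_pow_dvd_wronskian (c := s) ?_
    refine X_sub_C_pow_dvd_iff_hasseDeriv_eval_eq_zero.2 fun d hd => ?_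
    rw [← smul_eq_C_mul, map_sub, map_smul, eval_sub, eval_smul, smul_eq_mul, hj d (by omega),
      sub_self]
  have hcop : IsCoprime (minpoly ℚ α ^ n) ((X - C r) ^ J) := by
    refine IsCoprime.pow ?_
    refine ((minpoly.irreducible hα).coprime_iff_not_dvd).2 fun hd => ?_
    have := natDegree_le_of_dvd hd (X_sub_C_ne_zero r)
    rw [natDegree_X_sub_C] at this
    omega
  have hle := natDegree_le_of_dvd (hcop.mul_dvd h1 h2) hW
  rw [natDegree_mul (pow_ne_zero _ (minpoly.ne_zero hα)) (pow_ne_zero _ (X_sub_C_ne_zero r)),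
    natDegree_pow, natDegree_pow, natDegree_X_sub_C] at hle
  have := natDegree_wronskian_le hP hQ
  rw [mul_comm n] at hle
  omega

/-- If multiplication by `α` is given by an integer matrix in terms of `θ`, with `θ 0 = 1`, then
the powers of `α` have integer coordinates of at most geometric growth. -/
theorem exists_pow_eq_sum_mul {α : ℝ} {θ : Fin 4 → ℝ} {M : Matrix (Fin 4) (Fin 4) ℤ}
    (hθ : ∀ i, α * θ i = ∑ j, (M i j : ℝ) * θ j) (h1 : θ 0 = 1) :
    ∃ B : ℕ, 1 ≤ B ∧ ∃ c : ℕ → Fin 4 → ℤ, (∀ k, α ^ k = ∑ i, (c k i : ℝ) * θ i) ∧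
      ∀ k i, |c k i| ≤ (B : ℤ) ^ k := by
  set S : ℕ := ∑ i, ∑ j, (M i j).natAbs with hS
  have hMS : ∀ i j, |M i j| ≤ (S : ℤ) := by
    intro i j
    rw [Int.abs_eq_natAbs, hS]
    norm_cast
    exact (Finset.single_le_sum (f := fun j => (M i j).natAbs) (fun _ _ => Nat.zero_le _)
      (Finset.mem_univ j)).trans (Finset.single_le_sum (f := fun i => ∑ j, (M i j).natAbs)
      (fun _ _ => Nat.zero_le _) (Finset.mem_univ i))
  refine ⟨4 * S + 1, by omega, fun k => Nat.rec (Pi.single 0 1)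
    (fun _ v j => ∑ i, v i * M i j) k, fun k => ?_, fun k => ?_⟩
  · induction k with
    | zero => simp [Pi.single_apply, h1]
    | succ k ih =>
      rw [pow_succ, mul_comm, ih, Finset.mul_sum]
      push_cast
      simp_rw [Finset.sum_mul]
      rw [Finset.sum_comm]
      refine Finset.sum_congr rfl fun i _ => ?_
      rw [mul_left_comm, hθ, Finset.mul_sum]
      exact Finset.sum_congr rfl fun j _ => by ring
  · induction k with
    | zero =>
      intro i
      fin_cases i <;> simp
    | succ k ih =>
      intro j
      refine (Finset.abs_sum_le_sum_abs _ _).trans ?_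
      refine (Finset.sum_le_sum (g := fun _ => ((4 * S + 1 : ℕ) : ℤ) ^ k * S)
        fun i _ => ?_).trans ?_
      · rw [abs_mul]
        exact mul_le_mul (ih i) (hMS i j) (abs_nonneg _) (by positivity)
      · simp only [Finset.sum_const, Finset.card_univ, Fintype.card_fin, nsmul_eq_mul]
        have : (0 : ℤ) ≤ ((4 * S + 1 : ℕ) : ℤ) ^ k := by positivity
        rw [pow_succ]
        push_cast at this ⊢
        nlinarith

/-- Siegel's lemma in terms of bounds for the absolute values of the entries. -/
theorem exists_int_vec_ne_zero_abs_le {ι κ : Type*} [Fintype ι] [Fintype κ] (A : Matrix ι κ ℤ)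
    {T e : ℕ} (hT : 1 ≤ T) (hA : ∀ i j, |A i j| ≤ T) (h0 : 0 < Fintype.card ι)
    (hcard : Fintype.card ι < Fintype.card κ)
    (he : Fintype.card ι ≤ e * (Fintype.card κ - Fintype.card ι)) :
    ∃ t : κ → ℤ, t ≠ 0 ∧ A.mulVec t = 0 ∧ ∀ j, |t j| ≤ ((Fintype.card κ * T : ℕ) : ℤ) ^ e := by
  let _ : SeminormedAddCommGroup (Matrix ι κ ℤ) := Matrix.seminormedAddCommGroup
  obtain ⟨t, ht0, ht, htn⟩ := Int.Matrix.exists_ne_zero_int_vec_norm_le A hcard h0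
  refine ⟨t, ht0, ht, fun j => ?_⟩
  have hAT : ‖A‖ ≤ (T : ℝ) := by
    rw [Matrix.norm_le_iff (by positivity)]
    intro i j
    rw [Int.norm_eq_abs]
    exact_mod_cast hA i j
  have hT' : (1 : ℝ) ≤ T := by exact_mod_cast hT
  have hκ : (1 : ℝ) ≤ Fintype.card κ := by
    have : 1 ≤ Fintype.card κ := by omega
    exact_mod_cast this
  have hsub : (0 : ℝ) < (Fintype.card κ : ℝ) - Fintype.card ι := by
    rw [sub_pos]; exact_mod_cast hcard
  have hexp : (Fintype.card ι : ℝ) / ((Fintype.card κ : ℝ) - Fintype.card ι) ≤ e := by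
    rw [div_le_iff₀ hsub, ← Nat.cast_sub hcard.le]
    exact_mod_cast he
  have hb : (1 : ℝ) ≤ (Fintype.card κ : ℝ) * max 1 ‖A‖ :=
    one_le_mul_of_one_le_of_one_le hκ (le_max_left _ _)
  have : ((|t j| : ℤ) : ℝ) ≤ ((Fintype.card κ : ℝ) * T) ^ e := by
    calc ((|t j| : ℤ) : ℝ) = ‖t j‖ := by rw [Int.norm_eq_abs]; push_cast; rfl
      _ ≤ ‖t‖ := norm_le_pi_norm t j
      _ ≤ _ := htn
      _ ≤ ((Fintype.card κ : ℝ) * max 1 ‖A‖) ^ (e : ℝ) := Real.rpow_le_rpow_of_exponent_le hb hexp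
      _ = ((Fintype.card κ : ℝ) * max 1 ‖A‖) ^ e := Real.rpow_natCast _ _
      _ ≤ _ := by
        gcongr
        exact max_le hT' hAT
  exact_mod_cast this

/-- The auxiliary polynomials in Thue's method: integer polynomials of small degree and height such
that `P - α Q` vanishes to high order at `α`. -/
theorem exists_auxiliary_polynomials {α : ℝ} {θ : Fin 4 → ℝ} {M : Matrix (Fin 4) (Fin 4) ℤ}
    (hθ : ∀ i, α * θ i = ∑ j, (M i j : ℝ) * θ j) (h1 : θ 0 = 1) :
    ∃ C₀ : ℕ, 1 ≤ C₀ ∧ ∀ l : ℕ, 1 ≤ l → ∃ P Q : ℤ[X], (P ≠ 0 ∨ Q ≠ 0) ∧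
      P.natDegree ≤ 33 * l ∧ Q.natDegree ≤ 33 * l ∧
      (∀ k, |P.coeff k| ≤ (C₀ : ℤ) ^ l) ∧ (∀ k, |Q.coeff k| ≤ (C₀ : ℤ) ^ l) ∧
      (X - C α) ^ (16 * l) ∣ P.map (Int.castRingHom ℝ) - C α * Q.map (Int.castRingHom ℝ) := by
  obtain ⟨B, hB, c, hc, hcB⟩ := exists_pow_eq_sum_mul hθ h1
  refine ⟨(68 * (2 ^ 33 * B ^ 34)) ^ 32, Nat.one_le_pow _ _ (by positivity), fun l hl => ?_⟩
  let A : Matrix (Fin (16 * l) × Fin 4) (Bool × Fin (33 * l + 1)) ℤ := fun a b =>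
    (Nat.choose b.2 a.1 : ℤ) * (if b.1 then -c (b.2 - a.1 + 1) a.2 else c (b.2 - a.1) a.2)
  have hA : ∀ i j, |A i j| ≤ ((2 ^ (33 * l) * B ^ (34 * l) : ℕ) : ℤ) := by
    rintro ⟨j, i⟩ ⟨b, k⟩
    have hk : (k : ℕ) ≤ 33 * l := by omega
    simp only [A]
    rw [abs_mul]
    push_cast
    have hB' : (1 : ℤ) ≤ B := by exact_mod_cast hB
    refine mul_le_mul ?_ ?_ (abs_nonneg _) (by positivity)
    · rw [Nat.abs_cast]
      have : Nat.choose k j ≤ 2 ^ (33 * l) :=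
        (Nat.choose_le_two_pow _ _).trans (Nat.pow_le_pow_right (by norm_num) hk)
      exact_mod_cast this
    · split_ifs
      · rw [abs_neg]
        exact (hcB _ _).trans (pow_le_pow_right₀ hB' (by omega))
      · exact (hcB _ _).trans (pow_le_pow_right₀ hB' (by omega))
  have hcι : Fintype.card (Fin (16 * l) × Fin 4) = 64 * l := by simp; ring
  have hcκ : Fintype.card (Bool × Fin (33 * l + 1)) = 66 * l + 2 := by simp; ring
  obtain ⟨t, ht0, ht, htb⟩ := exists_int_vec_ne_zero_abs_le (e := 32) A
    (Nat.one_le_iff_ne_zero.2 (by positivity)) hA (by omega) (by omega) (by omega)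
  have htb' : ∀ j, |t j| ≤ (((68 * (2 ^ 33 * B ^ 34)) ^ 32 : ℕ) : ℤ) ^ l := by
    intro j
    refine (htb j).trans ?_
    rw [hcκ]
    norm_cast
    have h68 : 66 * l + 2 ≤ 68 ^ l := by
      clear * - hl
      induction l, hl using Nat.le_induction with
      | base => norm_num
      | succ n hn ih => rw [pow_succ]; omega
    calc ((66 * l + 2) * (2 ^ (33 * l) * B ^ (34 * l))) ^ 32
        ≤ (68 ^ l * (2 ^ (33 * l) * B ^ (34 * l))) ^ 32 := by gcongr
      _ = ((68 * (2 ^ 33 * B ^ 34)) ^ 32) ^ l := by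
        rw [pow_mul, pow_mul, ← mul_pow, ← mul_pow, ← pow_mul, ← pow_mul, mul_comm l]
  let R : Bool → ℤ[X] := fun b => ∑ k : Fin (33 * l + 1), monomial (k : ℕ) (t (b, k))
  have hRc : ∀ b (k : Fin (33 * l + 1)), (R b).coeff k = t (b, k) := by
    intro b k
    simp only [R, finsetSum_coeff, coeff_monomial]
    rw [Finset.sum_eq_single k]
    · simp
    · intro k' _ hk'
      rw [if_neg (fun h => hk' (Fin.ext h))]
    · simp
  have hRd : ∀ b, (R b).natDegree ≤ 33 * l := by
    intro b
    refine natDegree_sum_le_of_forall_le _ _ fun k _ => ?_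
    exact (natDegree_monomial_le _).trans (by omega)
  have hRb : ∀ b k, |(R b).coeff k| ≤ (((68 * (2 ^ 33 * B ^ 34)) ^ 32 : ℕ) : ℤ) ^ l := by
    intro b k
    by_cases hk : k < 33 * l + 1
    · exact (hRc b ⟨k, hk⟩) ▸ htb' _
    · rw [coeff_eq_zero_of_natDegree_lt (lt_of_le_of_lt (hRd b) (by omega)), abs_zero]
      positivity
  refine ⟨R false, R true, ?_, hRd _, hRd _, hRb _, hRb _, ?_⟩
  · by_contra! h0
    apply ht0
    ext ⟨b, k⟩
    rw [← hRc]
    cases b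
    · simp [h0.1]
    · simp [h0.2]
  · refine X_sub_C_pow_dvd_iff_hasseDeriv_eval_eq_zero.2 fun j hj => ?_
    have hrow : ∀ i, ∑ b, A (⟨j, hj⟩, i) b * t b = 0 := fun i => congrFun ht (⟨j, hj⟩, i)
    have key : ∑ i, ((∑ b, A (⟨j, hj⟩, i) b * t b : ℤ) : ℝ) * θ i = 0 := by
      simp [hrow]
    rw [← smul_eq_C_mul, map_sub, map_smul, eval_sub, eval_smul, smul_eq_mul]
    have hev : ∀ b, (hasseDeriv j ((R b).map (Int.castRingHom ℝ))).eval α =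
        ∑ k : Fin (33 * l + 1), (Nat.choose k j : ℝ) * t (b, k) * α ^ ((k : ℕ) - j) := by
      intro b
      simp only [R, Polynomial.map_sum, map_monomial, map_sum, hasseDeriv_monomial, eval_finsetSum,
        eval_monomial]
      rfl
    rw [hev, hev, ← key]
    simp_rw [Fintype.sum_prod_type, Fintype.sum_bool]
    push_cast
    simp_rw [add_mul, Finset.sum_add_distrib, Finset.sum_mul]
    refine Eq.trans ?_ (add_comm _ _)
    rw [sub_eq_add_neg, Finset.mul_sum, ← Finset.sum_neg_distrib]
    conv_rhs => congr <;> rw [Finset.sum_comm]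
    congr 1
    · refine Finset.sum_congr rfl fun k _ => ?_
      rw [hc, Finset.mul_sum]
      refine Finset.sum_congr rfl fun i _ => ?_
      simp [A]
      ring
    · refine Finset.sum_congr rfl fun k _ => ?_
      rw [mul_left_comm, ← pow_succ', hc, Finset.mul_sum, ← Finset.sum_neg_distrib]
      refine Finset.sum_congr rfl fun i _ => ?_
      simp [A]
      ring

theorem map_hasseDeriv {R S : Type*} [Semiring R] [Semiring S] (f : R →+* S) (j : ℕ) (p : R[X]) :
    (hasseDeriv j p).map f = hasseDeriv j (p.map f) := by
  ext k
  simp [hasseDeriv_coeff]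

theorem abs_hasseDeriv_eval_le_of_abs_pow_le {T : ℝ[X]} {m j : ℕ} {H b y : ℝ}
    (hT : T.natDegree ≤ m) (hH : ∀ k, |T.coeff k| ≤ H)
    (hb : ∀ k ≤ m, T.coeff k ≠ 0 → j ≤ k → |y| ^ (k - j) ≤ b) (hb0 : 0 ≤ b) :
    |(hasseDeriv j T).eval y| ≤ 4 ^ m * H * b := by
  have hH0 : 0 ≤ H := (abs_nonneg _).trans (hH 0)
  have hev : (hasseDeriv j T).eval y =
      ∑ k ∈ Finset.range (m + 1), (Nat.choose k j : ℝ) * T.coeff k * y ^ (k - j) := by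
    rw [hasseDeriv_apply, sum_over_range' _ _ (m + 1) (by omega)]
    · simp [eval_finsetSum, eval_monomial]
    · simp
  rw [hev]
  refine (Finset.abs_sum_le_sum_abs _ _).trans ?_
  refine (Finset.sum_le_sum (g := fun _ => 2 ^ m * H * b) fun k hk => ?_).trans ?_
  · rw [Finset.mem_range] at hk
    by_cases h0 : T.coeff k = 0
    · simp only [h0, mul_zero, zero_mul, abs_zero]
      positivity
    by_cases hjk : j ≤ k
    · rw [abs_mul, abs_mul, abs_pow, Nat.abs_cast]
      have hc : (Nat.choose k j : ℝ) ≤ 2 ^ m := by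
        have : Nat.choose k j ≤ 2 ^ m :=
          (Nat.choose_le_two_pow _ _).trans (Nat.pow_le_pow_right (by norm_num) (by omega))
        exact_mod_cast this
      have := hH k
      have := hb k (by omega) h0 hjk
      gcongr
    · rw [Nat.choose_eq_zero_of_lt (by omega)]
      simp only [Nat.cast_zero, zero_mul, abs_zero]
      positivity
  · have hm : ((m : ℝ) + 1) ≤ 2 ^ m := by
      exact_mod_cast Nat.lt_two_pow_self (n := m)
    rw [Finset.sum_const, Finset.card_range, nsmul_eq_mul]
    push_cast
    calc ((m : ℝ) + 1) * (2 ^ m * H * b) ≤ 2 ^ m * (2 ^ m * H * b) := by gcongr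
      _ = (2 * 2) ^ m * H * b := by rw [mul_pow]; ring
      _ = 4 ^ m * H * b := by norm_num

theorem abs_hasseDeriv_eval_le {T : ℝ[X]} {m : ℕ} {H A y : ℝ} (hT : T.natDegree ≤ m)
    (hH : ∀ k, |T.coeff k| ≤ H) (hA : 1 ≤ A) (hy : |y| ≤ A) (j : ℕ) :
    |(hasseDeriv j T).eval y| ≤ 4 ^ m * H * A ^ m := by
  refine abs_hasseDeriv_eval_le_of_abs_pow_le hT hH (fun k hk _ _ => ?_) (by positivity)
  exact (pow_le_pow_left₀ (abs_nonneg y) hy _).trans (pow_le_pow_right₀ hA (by omega))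

theorem abs_hasseDeriv_eval_le_of_X_sub_C_pow_dvd {G : ℝ[X]} {m n : ℕ} {H A a x : ℝ}
    (hG : G.natDegree ≤ m) (hH : ∀ k, |G.coeff k| ≤ H) (hA : 1 ≤ A) (ha : |a| ≤ A)
    (hx : |x - a| ≤ 1) (hdvd : (X - C a) ^ n ∣ G) (j : ℕ) :
    |(hasseDeriv j G).eval x| ≤ 4 ^ m * (4 ^ m * H * A ^ m) * |x - a| ^ (n - j) := by
  have he : (hasseDeriv j G).eval x = (hasseDeriv j (taylor a G)).eval (x - a) := by
    rw [← taylor_coeff, ← taylor_coeff, taylor_taylor, sub_add_cancel]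
  rw [he]
  refine abs_hasseDeriv_eval_le_of_abs_pow_le (by rwa [natDegree_taylor]) (fun k => ?_)
    (fun k _ hk hjk => ?_) (by positivity)
  · rw [taylor_coeff]
    exact abs_hasseDeriv_eval_le hG hH hA ha k
  · have hnk : n ≤ k := by
      by_contra! hlt
      refine hk ?_
      rw [taylor_coeff]
      exact X_sub_C_pow_dvd_iff_hasseDeriv_eval_eq_zero.1 hdvd k hlt
    exact pow_le_pow_of_le_one (abs_nonneg _) hx (by omega)

theorem exists_int_eq_pow_mul_eval_div {R : ℤ[X]} {m : ℕ} (hR : R.natDegree ≤ m) (p q : ℤ)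
    (hq : q ≠ 0) :
    ∃ z : ℤ, (z : ℝ) = (q : ℝ) ^ m * (R.map (Int.castRingHom ℝ)).eval (p / q : ℝ) := by
  have hq' : (q : ℝ) ≠ 0 := by exact_mod_cast hq
  have hbu : (q : ℝ)⁻¹ * Int.castRingHom ℝ q = 1 := by simp [hq']
  obtain ⟨D, bi, hbi, hD⟩ := denomsClearable_of_natDegree_le m p hbu R hR
  refine ⟨D, ?_⟩
  have : bi = (q : ℝ)⁻¹ := by
    simp only [eq_intCast] at hbi
    exact eq_inv_of_mul_eq_one_left hbi
  rw [this] at hD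
  simpa [div_eq_mul_inv] using hD

theorem one_le_pow_mul_mul_abs_sub {R S : ℤ[X]} {m : ℕ} (hR : R.natDegree ≤ m)
    (hS : S.natDegree ≤ m) {p₁ q₁ p₂ q₂ : ℤ} (hq₁ : 0 < q₁) (hq₂ : 0 < q₂)
    (hne : (R.map (Int.castRingHom ℝ)).eval (p₁ / q₁ : ℝ) ≠
      (p₂ / q₂ : ℝ) * (S.map (Int.castRingHom ℝ)).eval (p₁ / q₁ : ℝ)) :
    1 ≤ (q₁ : ℝ) ^ m * q₂ * |(R.map (Int.castRingHom ℝ)).eval (p₁ / q₁ : ℝ) -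
      (p₂ / q₂ : ℝ) * (S.map (Int.castRingHom ℝ)).eval (p₁ / q₁ : ℝ)| := by
  obtain ⟨u, hu⟩ := exists_int_eq_pow_mul_eval_div hR p₁ q₁ hq₁.ne'
  obtain ⟨v, hv⟩ := exists_int_eq_pow_mul_eval_div hS p₁ q₁ hq₁.ne'
  set r := (R.map (Int.castRingHom ℝ)).eval (p₁ / q₁ : ℝ)
  set s := (S.map (Int.castRingHom ℝ)).eval (p₁ / q₁ : ℝ)
  have h1 : (0 : ℝ) < q₁ := by exact_mod_cast hq₁
  have h2 : (0 : ℝ) < q₂ := by exact_mod_cast hq₂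
  have he : ((q₂ * u - p₂ * v : ℤ) : ℝ) = (q₁ : ℝ) ^ m * q₂ * (r - (p₂ / q₂ : ℝ) * s) := by
    push_cast
    rw [hu, hv]
    field_simp
  have hpos : (0 : ℝ) < (q₁ : ℝ) ^ m * q₂ := by positivity
  rw [← abs_of_pos hpos, ← abs_mul, ← he]
  have hz : q₂ * u - p₂ * v ≠ 0 := by
    intro h0
    rw [h0, Int.cast_zero, eq_comm, mul_eq_zero] at he
    rcases he with he | he
    · exact hpos.ne' he
    · exact hne (sub_eq_zero.1 he)
  exact_mod_cast Int.one_le_abs hz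

/-- Thue's theorem for quartic irrationalities, for an approximation exponent `4`. -/
theorem exists_bound_of_abs_sub_div_le {α : ℝ} {θ : Fin 4 → ℝ} {M : Matrix (Fin 4) (Fin 4) ℤ}
    (hθ : ∀ i, α * θ i = ∑ j, (M i j : ℝ) * θ j) (h1 : θ 0 = 1)
    (hdeg : 4 ≤ (minpoly ℚ α).natDegree) (K : ℝ) :
    ∃ B : ℤ, ∀ p q : ℤ, 0 < q → |α - p / q| ≤ K / q ^ 4 → q ≤ B := by
  wlog hK : 1 ≤ K generalizing K
  · obtain ⟨B, hB⟩ := this (max 1 K) (le_max_left _ _)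
    refine ⟨B, fun p q hq h => hB p q hq (h.trans ?_)⟩
    gcongr
    exact le_max_right _ _
  by_contra! hcon
  obtain ⟨C₀, hC₀, haux⟩ := exists_auxiliary_polynomials hθ h1
  have hC₀' : (1 : ℝ) ≤ C₀ := by exact_mod_cast hC₀
  set A : ℝ := |α| + 1 with hA
  have hA1 : 1 ≤ A := by rw [hA]; linarith [abs_nonneg α]
  have hA0 : 0 < A := by linarith
  set E : ℝ := 16 ^ 33 * A ^ 34 * C₀ with hE
  have hE0 : 0 < E := by positivity
  obtain ⟨p₁, q₁, hq₁, happ₁, hbig₁⟩ := hcon (⌈max (2 * E * K ^ 14) K⌉ + 1)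
  have hQ₁E : 2 * E * K ^ 14 < q₁ := by
    have : ((⌈max (2 * E * K ^ 14) K⌉ + 1 : ℤ) : ℝ) < q₁ := by exact_mod_cast hbig₁
    push_cast at this
    linarith [Int.le_ceil (max (2 * E * K ^ 14) K), le_max_left (2 * E * K ^ 14) K]
  have hQ₁K : K < q₁ := by
    have : ((⌈max (2 * E * K ^ 14) K⌉ + 1 : ℤ) : ℝ) < q₁ := by exact_mod_cast hbig₁
    push_cast at this
    linarith [Int.le_ceil (max (2 * E * K ^ 14) K), le_max_right (2 * E * K ^ 14) K]
  have hQ₁ : (1 : ℝ) < q₁ := hK.trans_lt hQ₁K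
  have hQ₁0 : (0 : ℝ) < q₁ := by linarith
  obtain ⟨p₂, q₂, hq₂, happ₂, hbig₂⟩ := hcon ((q₁ ^ 16) ^ 36)
  have hQ₂0 : (0 : ℝ) < q₂ := by exact_mod_cast hq₂
  obtain ⟨l, hl, hlow, hupp⟩ : ∃ l : ℕ, 36 ≤ l ∧ (q₁ : ℝ) ^ (16 * l) ≤ q₂ ∧
      (q₂ : ℝ) ≤ (q₁ : ℝ) ^ (16 * l + 16) := by
    have hb : 1 < q₁.toNat ^ 16 := by
      have : 1 < q₁ := by exact_mod_cast hQ₁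
      exact Nat.one_lt_pow (by norm_num) (by omega)
    have hq₁n : ((q₁.toNat : ℕ) : ℤ) = q₁ := Int.toNat_of_nonneg hq₁.le
    have hq₂n : ((q₂.toNat : ℕ) : ℤ) = q₂ := Int.toNat_of_nonneg hq₂.le
    have hq₁r : (q₁ : ℝ) = (q₁.toNat : ℝ) := by exact_mod_cast hq₁n.symm
    have hq₂r : (q₂ : ℝ) = (q₂.toNat : ℝ) := by exact_mod_cast hq₂n.symm
    have h0 : q₂.toNat ≠ 0 := by omega
    refine ⟨Nat.log (q₁.toNat ^ 16) q₂.toNat, ?_, ?_, ?_⟩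
    · refine Nat.le_log_of_pow_le hb ?_
      rw [← hq₁n, ← hq₂n] at hbig₂
      exact_mod_cast hbig₂.le
    · rw [hq₁r, hq₂r, pow_mul]
      exact_mod_cast Nat.pow_log_le_self _ h0
    · rw [hq₁r, hq₂r, ← mul_add_one, pow_mul]
      exact_mod_cast (Nat.lt_pow_succ_log_self hb _).le
  obtain ⟨P, Q, hPQ, hPd, hQd, hPc, hQc, hdvd⟩ := haux l (by omega)
  have hinj : Function.Injective (Int.castRingHom ℚ) := Int.cast_injective
  have hcomp : (algebraMap ℚ ℝ).comp (Int.castRingHom ℚ) = Int.castRingHom ℝ :=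
    RingHom.ext_int _ _
  obtain ⟨j, hj, hne⟩ := exists_hasseDeriv_eval_ne (α := α) (n := 16 * l - 1) (m := 33 * l)
    (J := 2 * l + 5) (by omega)
    (lt_of_lt_of_le (by omega) (Nat.mul_le_mul_right (16 * l - 1 + 1) hdeg))
    (lt_of_lt_of_le (by omega) (Nat.add_le_add_right (Nat.mul_le_mul_right (16 * l - 1) hdeg) _))
    (P := P.map (Int.castRingHom ℚ)) (Q := Q.map (Int.castRingHom ℚ))
    (by simpa [Polynomial.map_eq_zero_iff hinj] using hPQ)
    (natDegree_map_le.trans hPd) (natDegree_map_le.trans hQd)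
    (by rwa [Nat.sub_add_cancel (by omega), Polynomial.map_map, Polynomial.map_map, hcomp])
    (p₁ / q₁) (p₂ / q₂)
  have hne' : ((hasseDeriv j P).map (Int.castRingHom ℝ)).eval (p₁ / q₁ : ℝ) ≠
      (p₂ / q₂ : ℝ) * ((hasseDeriv j Q).map (Int.castRingHom ℝ)).eval (p₁ / q₁ : ℝ) := by
    have hev : ∀ R : ℤ[X], ((hasseDeriv j R).map (Int.castRingHom ℝ)).eval (p₁ / q₁ : ℝ) =
        (((hasseDeriv j (R.map (Int.castRingHom ℚ))).eval (p₁ / q₁ : ℚ) : ℚ) : ℝ) := by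
      intro R
      have := eval_map_apply (f := algebraMap ℚ ℝ) (p := hasseDeriv j (R.map (Int.castRingHom ℚ)))
        (p₁ / q₁ : ℚ)
      rw [← map_hasseDeriv, Polynomial.map_map, hcomp] at this
      rw [← map_hasseDeriv]
      simpa using this
    rw [hev, hev]
    exact_mod_cast hne
  have hlower := one_le_pow_mul_mul_abs_sub (m := 33 * l)
    ((natDegree_hasseDeriv_le P j).trans (by omega))
    ((natDegree_hasseDeriv_le Q j).trans (by omega)) hq₁ hq₂ hne'
  set x : ℝ := p₁ / q₁ with hx
  set y : ℝ := p₂ / q₂ with hy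
  have hxa : |x - α| ≤ K / (q₁ : ℝ) ^ 4 := by rwa [abs_sub_comm]
  have hxa1 : |x - α| ≤ 1 := by
    refine hxa.trans ((div_le_one (by positivity)).2 (hQ₁K.le.trans ?_))
    exact le_self_pow₀ hQ₁.le (by norm_num)
  have hxA : |x| ≤ A := by
    have := abs_add_le (x - α) α
    rw [sub_add_cancel] at this
    linarith
  have hrc : ∀ R : ℤ[X], (∀ k, |R.coeff k| ≤ (C₀ : ℤ) ^ l) →
      ∀ k, |(R.map (Int.castRingHom ℝ)).coeff k| ≤ (C₀ : ℝ) ^ l := by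
    intro R hR k
    rw [coeff_map, eq_intCast]
    exact_mod_cast hR k
  have hAl : A ≤ A ^ l := le_self_pow₀ hA1 (by omega)
  set G : ℝ[X] := P.map (Int.castRingHom ℝ) - C α * Q.map (Int.castRingHom ℝ) with hG
  have hGd : G.natDegree ≤ 33 * l := by
    refine (natDegree_sub_le _ _).trans (max_le (natDegree_map_le.trans hPd) ?_)
    exact (natDegree_C_mul_le _ _).trans (natDegree_map_le.trans hQd)
  have hGc : ∀ k, |G.coeff k| ≤ (C₀ : ℝ) ^ l * A ^ l := by
    intro k
    rw [hG, coeff_sub, coeff_C_mul]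
    refine (abs_sub _ _).trans ?_
    rw [abs_mul]
    have h1 := hrc P hPc k
    have h2 := hrc Q hQc k
    have h3 := mul_le_mul_of_nonneg_left h2 (abs_nonneg α)
    have h4 : (C₀ : ℝ) ^ l * A ≤ (C₀ : ℝ) ^ l * A ^ l := by gcongr
    rw [hA] at h4 ⊢
    linarith
  have hGj : |(hasseDeriv j G).eval x| ≤ E ^ l * |x - α| ^ (16 * l - j) := by
    refine (abs_hasseDeriv_eval_le_of_X_sub_C_pow_dvd hGd hGc hA1 (by linarith) hxa1 hdvd
      j).trans (le_of_eq ?_)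
    congr 1
    calc (4 : ℝ) ^ (33 * l) * (4 ^ (33 * l) * (C₀ ^ l * A ^ l) * A ^ (33 * l))
        = ((4 * 4) ^ 33 * A ^ 34 * C₀) ^ l := by
          rw [mul_pow _ (C₀ : ℝ), mul_pow _ (A ^ 34), ← pow_mul, ← pow_mul, mul_pow]; ring
      _ = E ^ l := by rw [hE]; norm_num
  have hQj : |((hasseDeriv j Q).map (Int.castRingHom ℝ)).eval x| ≤ E ^ l := by
    rw [map_hasseDeriv]
    refine (abs_hasseDeriv_eval_le (natDegree_map_le.trans hQd) (hrc Q hQc) hA1 hxA j).trans ?_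
    calc 4 ^ (33 * l) * (C₀ : ℝ) ^ l * A ^ (33 * l) = (4 ^ 33 * A ^ 33 * C₀) ^ l := by
          rw [mul_pow, mul_pow, ← pow_mul, ← pow_mul]; ring
      _ ≤ E ^ l := by
        rw [hE]
        gcongr <;> norm_num
  have hdecomp : ((hasseDeriv j P).map (Int.castRingHom ℝ)).eval x -
      y * ((hasseDeriv j Q).map (Int.castRingHom ℝ)).eval x =
      (hasseDeriv j G).eval x + (α - y) * ((hasseDeriv j Q).map (Int.castRingHom ℝ)).eval x := by
    rw [hG, ← smul_eq_C_mul, map_sub, map_smul, eval_sub, eval_smul, smul_eq_mul, map_hasseDeriv,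
      map_hasseDeriv]
    ring
  rw [hdecomp] at hlower
  have hterm₁ : (q₁ : ℝ) ^ (33 * l) * q₂ * |(hasseDeriv j G).eval x| * (q₁ : ℝ) ^ (6 * l) ≤
      E ^ l * K ^ (14 * l) := by
    have hδ : |x - α| ^ (16 * l - j) ≤ K ^ (14 * l) / (q₁ : ℝ) ^ (56 * l - 20) := by
      calc |x - α| ^ (16 * l - j) ≤ |x - α| ^ (14 * l - 5) :=
            pow_le_pow_of_le_one (abs_nonneg _) hxa1 (by omega)
        _ ≤ (K / (q₁ : ℝ) ^ 4) ^ (14 * l - 5) := by gcongr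
        _ = K ^ (14 * l - 5) / (q₁ : ℝ) ^ (56 * l - 20) := by
          rw [div_pow, ← pow_mul]
          congr 2
          omega
        _ ≤ K ^ (14 * l) / (q₁ : ℝ) ^ (56 * l - 20) := by
          gcongr ?_ / _
          exact pow_le_pow_right₀ hK (Nat.sub_le _ _)
    have hpow : (q₁ : ℝ) ^ (33 * l) * q₂ * (q₁ : ℝ) ^ (6 * l) ≤ (q₁ : ℝ) ^ (56 * l - 20) := by
      calc (q₁ : ℝ) ^ (33 * l) * q₂ * (q₁ : ℝ) ^ (6 * l)
          ≤ (q₁ : ℝ) ^ (33 * l) * (q₁ : ℝ) ^ (16 * l + 16) * (q₁ : ℝ) ^ (6 * l) := by gcongr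
        _ = (q₁ : ℝ) ^ (33 * l + (16 * l + 16) + 6 * l) := by
          rw [pow_add _ _ (6 * l), pow_add _ (33 * l)]
        _ ≤ _ := pow_le_pow_right₀ hQ₁.le (by omega)
    calc (q₁ : ℝ) ^ (33 * l) * q₂ * |(hasseDeriv j G).eval x| * (q₁ : ℝ) ^ (6 * l)
        = (q₁ : ℝ) ^ (33 * l) * q₂ * (q₁ : ℝ) ^ (6 * l) * |(hasseDeriv j G).eval x| := by ring
      _ ≤ (q₁ : ℝ) ^ (56 * l - 20) * (E ^ l * (K ^ (14 * l) / (q₁ : ℝ) ^ (56 * l - 20))) := by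
        gcongr
        exact hGj.trans (by gcongr)
      _ = E ^ l * K ^ (14 * l) := by field_simp
  have hterm₂ : (q₁ : ℝ) ^ (33 * l) * q₂ *
      |(α - y) * ((hasseDeriv j Q).map (Int.castRingHom ℝ)).eval x| * (q₁ : ℝ) ^ (6 * l) ≤
      E ^ l * K ^ (14 * l) := by
    have hpow : (q₁ : ℝ) ^ (33 * l) * (q₁ : ℝ) ^ (6 * l) ≤ (q₂ : ℝ) ^ 3 := by
      calc (q₁ : ℝ) ^ (33 * l) * (q₁ : ℝ) ^ (6 * l) = (q₁ : ℝ) ^ (33 * l + 6 * l) := by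
            rw [pow_add]
        _ ≤ (q₁ : ℝ) ^ (16 * l * 3) := pow_le_pow_right₀ hQ₁.le (by omega)
        _ = ((q₁ : ℝ) ^ (16 * l)) ^ 3 := pow_mul _ _ _
        _ ≤ (q₂ : ℝ) ^ 3 := by gcongr
    rw [abs_mul]
    calc (q₁ : ℝ) ^ (33 * l) * q₂ *
          (|α - y| * |((hasseDeriv j Q).map (Int.castRingHom ℝ)).eval x|) * (q₁ : ℝ) ^ (6 * l)
        = (q₁ : ℝ) ^ (33 * l) * (q₁ : ℝ) ^ (6 * l) * (q₂ *
          (|α - y| * |((hasseDeriv j Q).map (Int.castRingHom ℝ)).eval x|)) := by ring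
      _ ≤ (q₂ : ℝ) ^ 3 * (q₂ * (K / (q₂ : ℝ) ^ 4 * E ^ l)) := by gcongr
      _ = E ^ l * K := by field_simp
      _ ≤ E ^ l * K ^ (14 * l) := by
        gcongr
        exact le_self_pow₀ hK (by omega)
  have hub : (q₁ : ℝ) ^ (6 * l) ≤ 2 * (E ^ l * K ^ (14 * l)) := by
    have habs := abs_add_le ((hasseDeriv j G).eval x)
      ((α - y) * ((hasseDeriv j Q).map (Int.castRingHom ℝ)).eval x)
    have h2 := hlower.trans (mul_le_mul_of_nonneg_left habs
      (by positivity : (0 : ℝ) ≤ (q₁ : ℝ) ^ (33 * l) * q₂))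
    have h3 := mul_le_mul_of_nonneg_right h2 (by positivity : (0 : ℝ) ≤ (q₁ : ℝ) ^ (6 * l))
    rw [one_mul, mul_add, add_mul] at h3
    linarith
  have hlb : 2 * (E ^ l * K ^ (14 * l)) < (q₁ : ℝ) ^ (6 * l) := by
    calc 2 * (E ^ l * K ^ (14 * l)) ≤ 2 ^ l * (E ^ l * K ^ (14 * l)) := by
          gcongr
          exact le_self_pow₀ one_le_two (by omega)
      _ = (2 * E * K ^ 14) ^ l := by
        rw [mul_pow _ (K ^ 14), mul_pow 2 E, ← pow_mul, mul_assoc]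
      _ < (q₁ : ℝ) ^ l := pow_lt_pow_left₀ hQ₁E (by positivity) (by omega)
      _ ≤ (q₁ : ℝ) ^ (6 * l) := pow_le_pow_right₀ hQ₁.le (by omega)
  linarith

section Biquadratic

variable {s t : ℝ} {D₁ D₂ : ℤ}

/-- `1, √D₁, √D₂, √(D₁ D₂)` are linearly independent over `ℚ` if none of the last three is
rational. -/
theorem biquadratic_coeff_eq_zero (hs : s ^ 2 = D₁) (ht : t ^ 2 = D₂) (his : Irrational s)
    (hit : Irrational t) (hist : Irrational (s * t)) {a b c d : ℚ}
    (h : (a : ℝ) + b * s + c * t + d * (s * t) = 0) : a = 0 ∧ b = 0 ∧ c = 0 ∧ d = 0 := by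
  have lin : ∀ {r : ℝ}, Irrational r → ∀ u v : ℚ, (u : ℝ) + v * r = 0 → u = 0 ∧ v = 0 := by
    intro r hr u v huv
    have hv : v = 0 := by
      by_contra hv
      have hv' : (v : ℝ) ≠ 0 := by exact_mod_cast hv
      refine hr ⟨-u / v, ?_⟩
      push_cast
      field_simp
      linarith
    refine ⟨?_, hv⟩
    simpa [hv] using huv
  have hcd : c = 0 ∧ d = 0 := by
    by_contra hcd
    have hN : c ^ 2 - d ^ 2 * D₁ ≠ 0 := by
      intro hN
      have hN' : ((c : ℝ) + d * s) * (c + (-d : ℚ) * s) = 0 := by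
        have : (c : ℝ) ^ 2 - d ^ 2 * D₁ = 0 := by exact_mod_cast hN
        push_cast
        linear_combination this - (d : ℝ) ^ 2 * hs
      rcases mul_eq_zero.1 hN' with h0 | h0
      · exact hcd (lin his _ _ h0)
      · exact hcd ⟨(lin his _ _ h0).1, neg_eq_zero.1 (lin his _ _ h0).2⟩
    set N : ℚ := c ^ 2 - d ^ 2 * D₁ with hNdef
    set u : ℚ := b * d * D₁ - a * c with hu
    set v : ℚ := a * d - b * c with hv
    have hNt : (N : ℝ) * t = u + v * s := by
      rw [hNdef, hu, hv]
      push_cast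
      linear_combination (c - d * s) * h + (d ^ 2 * t + b * d) * hs
    have huv : 2 * u * v = 0 := by
      refine (lin his (u ^ 2 + v ^ 2 * D₁ - N ^ 2 * D₂) (2 * u * v) ?_).2
      push_cast
      linear_combination (-(N * t) - (u + v * s)) * hNt - (v : ℝ) ^ 2 * hs + (N : ℝ) ^ 2 * ht
    rcases mul_eq_zero.1 huv with h0 | h0
    · have hu0 : u = 0 := by simpa using h0
      rw [hu0, Rat.cast_zero, zero_add] at hNt
      refine hN (lin hist (-(v * D₁)) N ?_).2
      push_cast
      linear_combination s * hNt + v * hs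
    · rw [h0, Rat.cast_zero, zero_mul, add_zero] at hNt
      refine hN (lin hit (-u) N ?_).2
      push_cast
      linear_combination hNt
  rw [hcd.1, hcd.2, Rat.cast_zero, zero_mul, zero_mul, add_zero, add_zero] at h
  exact ⟨(lin his _ _ h).1, (lin his _ _ h).2, hcd⟩

/-- The value of a rational polynomial at `a + b √D₁ + c √D₂ + d √(D₁ D₂)`, simultaneously for all
choices of the signs of the square roots. -/
theorem exists_aeval_eq_biquadratic (hs : s ^ 2 = D₁) (ht : t ^ 2 = D₂) (a b c d : ℤ) (g : ℚ[X]) :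
    ∃ A B C D : ℚ, ∀ ε δ : ℤˣ,
      aeval ((a : ℝ) + b * (ε * s) + c * (δ * t) + d * (ε * s * (δ * t))) g =
        (A : ℝ) + B * (ε * s) + C * (δ * t) + D * (ε * s * (δ * t)) := by
  induction g using Polynomial.induction_on with
  | C r => exact ⟨r, 0, 0, 0, by simp⟩
  | add p q hp hq =>
    obtain ⟨A, B, C, D, h⟩ := hp
    obtain ⟨A', B', C', D', h'⟩ := hq
    refine ⟨A + A', B + B', C + C', D + D', fun ε δ => ?_⟩
    rw [map_add, h, h']
    push_cast
    ring
  | monomial n r ih =>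
    obtain ⟨A, B, C, D, h⟩ := ih
    refine ⟨A * a + B * b * D₁ + C * c * D₂ + D * d * (D₁ * D₂),
      A * b + B * a + C * d * D₂ + D * c * D₂, A * c + C * a + B * d * D₁ + D * b * D₁,
      A * d + D * a + B * c + C * b, fun ε δ => ?_⟩
    rw [show Polynomial.C r * X ^ (n + 1) = Polynomial.C r * X ^ n * X by ring, map_mul, h,
      aeval_X]
    have sq : ∀ η : ℤˣ, ((η : ℤ) : ℝ) ^ 2 = 1 := by
      intro η
      have : ((η : ℤ)) ^ 2 = 1 := by
        rw [← Units.val_pow_eq_pow_val, Int.units_sq, Units.val_one]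
      exact_mod_cast this
    have hS : (((ε : ℤ) : ℝ) * s) ^ 2 = D₁ := by rw [mul_pow, sq, one_mul, hs]
    have hT : (((δ : ℤ) : ℝ) * t) ^ 2 = D₂ := by rw [mul_pow, sq, one_mul, ht]
    generalize ((ε : ℤ) : ℝ) * s = S at *
    generalize ((δ : ℤ) : ℝ) * t = T at *
    push_cast
    linear_combination (B * b + B * d * T + D * b * T + D * d * T ^ 2) * hS +
      (C * c + C * d * S + D * c * S + D * d * D₁) * hT

theorem isIntegral_biquadratic (hs : s ^ 2 = D₁) (ht : t ^ 2 = D₂) (a b c d : ℤ) :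
    IsIntegral ℚ ((a : ℝ) + b * s + c * t + d * (s * t)) := by
  have hsi : IsIntegral ℚ s := IsIntegral.of_pow two_pos (by
    rw [hs]; exact_mod_cast isIntegral_algebraMap (R := ℚ) (A := ℝ) (x := (D₁ : ℚ)))
  have hti : IsIntegral ℚ t := IsIntegral.of_pow two_pos (by
    rw [ht]; exact_mod_cast isIntegral_algebraMap (R := ℚ) (A := ℝ) (x := (D₂ : ℚ)))
  have hz : ∀ n : ℤ, IsIntegral ℚ (n : ℝ) := fun n => by
    exact_mod_cast isIntegral_algebraMap (R := ℚ) (A := ℝ) (x := (n : ℚ))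
  exact (((hz a).add ((hz b).mul hsi)).add ((hz c).mul hti)).add ((hz d).mul (hsi.mul hti))

theorem four_le_natDegree_minpoly_biquadratic (hs : s ^ 2 = D₁) (ht : t ^ 2 = D₂)
    (his : Irrational s) (hit : Irrational t) (hist : Irrational (s * t)) {a b c d : ℤ}
    (hb : b ≠ 0) (hc : c ≠ 0) :
    4 ≤ (minpoly ℚ ((a : ℝ) + b * s + c * t + d * (s * t))).natDegree := by
  classical
  set f := minpoly ℚ ((a : ℝ) + b * s + c * t + d * (s * t)) with hf
  have hf0 : f ≠ 0 := minpoly.ne_zero (isIntegral_biquadratic hs ht a b c d)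
  let φ : ℤˣ × ℤˣ → ℝ := fun η =>
    (a : ℝ) + b * (η.1 * s) + c * (η.2 * t) + d * (η.1 * s * (η.2 * t))
  have hφ : Function.Injective φ := by
    rintro ⟨ε, δ⟩ ⟨ε', δ'⟩ h
    simp only [φ] at h
    obtain ⟨-, h1, h2, -⟩ := biquadratic_coeff_eq_zero hs ht his hit hist (a := 0)
      (b := b * (ε - ε')) (c := c * (δ - δ')) (d := d * (ε * δ - ε' * δ')) (by
        push_cast
        linear_combination h)
    have e1 : ((ε : ℤ) : ℚ) = ε' := by
      rcases mul_eq_zero.1 h1 with h0 | h0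
      · exact absurd (by exact_mod_cast h0) hb
      · exact sub_eq_zero.1 h0
    have e2 : ((δ : ℤ) : ℚ) = δ' := by
      rcases mul_eq_zero.1 h2 with h0 | h0
      · exact absurd (by exact_mod_cast h0) hc
      · exact sub_eq_zero.1 h0
    exact Prod.ext (Units.ext (by exact_mod_cast e1)) (Units.ext (by exact_mod_cast e2))
  obtain ⟨A, B, C, D, hev⟩ := exists_aeval_eq_biquadratic hs ht a b c d f
  have h1 := hev 1 1
  simp only [Units.val_one, Int.cast_one, one_mul] at h1
  rw [hf, minpoly.aeval] at h1
  obtain ⟨hA, hB, hC, hD⟩ := biquadratic_coeff_eq_zero hs ht his hit hist h1.symm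
  have hroot : ∀ η, φ η ∈ (f.map (algebraMap ℚ ℝ)).roots := by
    intro η
    rw [mem_roots (Polynomial.map_ne_zero hf0), IsRoot.def, eval_map, ← aeval_def, hev]
    simp [hA, hB, hC, hD]
  have hcard := card_le_degree_of_subset_roots (p := f.map (algebraMap ℚ ℝ))
    (Z := Finset.univ.image φ) (by
      intro x hx
      obtain ⟨η, -, rfl⟩ := Finset.mem_image.1 (Finset.mem_def.2 hx)
      exact hroot η)
  rw [Finset.card_image_of_injective _ hφ, natDegree_map] at hcard
  simpa using hcard

/-- The case `α = a + b √D₁ + c √D₂ + d √(D₁ D₂)` of Thue's theorem. -/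
theorem exists_bound_of_abs_biquadratic_sub_div_le (hs : s ^ 2 = D₁) (ht : t ^ 2 = D₂)
    (his : Irrational s) (hit : Irrational t) (hist : Irrational (s * t)) {a b c d : ℤ}
    (hb : b ≠ 0) (hc : c ≠ 0) (K : ℝ) :
    ∃ B : ℤ, ∀ p q : ℤ, 0 < q →
      |((a : ℝ) + b * s + c * t + d * (s * t)) - p / q| ≤ K / q ^ 4 → q ≤ B := by
  refine exists_bound_of_abs_sub_div_le (θ := ![1, s, t, s * t])
    (M := !![a, b, c, d; b * D₁, a, d * D₁, c; c * D₂, d * D₂, a, b;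
      d * D₁ * D₂, c * D₂, b * D₁, a]) (fun i => ?_) rfl
    (four_le_natDegree_minpoly_biquadratic hs ht his hit hist hb hc) K
  fin_cases i
  · simp [Fin.sum_univ_four]
  · simp [Fin.sum_univ_four]
    linear_combination (b + d * t) * hs
  · simp [Fin.sum_univ_four]
    linear_combination (c + d * s) * ht
  · simp [Fin.sum_univ_four]
    linear_combination (b * t + d * t ^ 2) * hs + (c * s + d * D₁) * ht

end Biquadratic

theorem Irrational.exists_pos_le_abs_sub_div {α : ℝ} (hα : Irrational α) (B : ℤ) :
    ∃ η : ℝ, 0 < η ∧ ∀ p q : ℤ, 0 < q → q ≤ B → η ≤ |α - p / q| := by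
  set N : ℕ := B.toNat.factorial with hN
  have hN0 : N ≠ 0 := Nat.factorial_ne_zero _
  have hNpos : (0 : ℝ) < N := by exact_mod_cast Nat.pos_of_ne_zero hN0
  refine ⟨|N * α - round (N * α)| / N, div_pos (abs_pos.2 (sub_ne_zero.2 ?_)) hNpos,
    fun p q hq hqB => ?_⟩
  · exact (hα.natCast_mul hN0).ne_int _
  · obtain ⟨k, hk⟩ : q ∣ N := by
      have : q.toNat ∣ N := Nat.dvd_factorial (by omega) (by omega)
      rw [← Int.toNat_of_nonneg hq.le]
      exact_mod_cast this
    have hq' : (0 : ℝ) < q := by exact_mod_cast hq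
    have hk' : (N : ℝ) = q * k := by exact_mod_cast hk
    rw [div_le_iff₀ hNpos]
    refine (round_le (N * α) (k * p)).trans (le_of_eq ?_)
    rw [← abs_of_pos hNpos, ← abs_mul, abs_of_pos hNpos]
    congr 1
    push_cast
    rw [hk']
    field_simp

section Pell

theorem pell_dvd_of_isCoprime {D₁ D₂ e₁ e₂ X₀ Y₀ z₀ X Y z p q g : ℤ}
    (h₁₀ : X₀ ^ 2 - D₁ * z₀ ^ 2 = e₁) (h₂₀ : Y₀ ^ 2 - D₂ * z₀ ^ 2 = e₂)
    (h₁ : X ^ 2 - D₁ * z ^ 2 = e₁) (h₂ : Y ^ 2 - D₂ * z ^ 2 = e₂) (hg : g ≠ 0)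
    (hp : z₀ * X - X₀ * z = g * p) (hq : z₀ * Y - Y₀ * z = g * q) (hpq : IsCoprime p q) :
    e₂ * p ^ 2 - e₁ * q ^ 2 ∣ 2 * z * (e₁ * e₂ * (e₂ * D₁ - e₁ * D₂) * z₀ ^ 2) := by
  have hQ : g * (e₂ * p ^ 2 - e₁ * q ^ 2) = -2 * z * (e₂ * X₀ * p - e₁ * Y₀ * q) := by
    refine mul_left_cancel₀ hg ?_
    linear_combination e₂ * z₀ ^ 2 * h₁ - e₂ * z ^ 2 * h₁₀ - e₁ * z₀ ^ 2 * h₂ + e₁ * z ^ 2 * h₂₀ -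
      e₂ * (g * p + (z₀ * X - X₀ * z) + 2 * z * X₀) * hp +
      e₁ * (g * q + (z₀ * Y - Y₀ * z) + 2 * z * Y₀) * hq
  have hR : e₁ * e₂ * (e₂ * D₁ - e₁ * D₂) * z₀ ^ 2 =
      e₁ * e₂ * (e₂ * X₀ ^ 2 - e₁ * Y₀ ^ 2) := by
    linear_combination (-(e₁ * e₂ * e₂)) * h₁₀ + e₁ * e₁ * e₂ * h₂₀
  rw [hR]
  obtain ⟨m, n, hmn⟩ := hpq.pow (m := 2) (n := 2)
  set l := e₂ * X₀ * p + e₁ * Y₀ * q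
  refine ⟨-(m * (2 * z * (e₁ * Y₀) ^ 2 + e₁ * g * l) +
    n * (2 * z * (e₂ * X₀) ^ 2 + e₂ * g * l)), ?_⟩
  linear_combination (-(2 * z * (e₁ * e₂ * (e₂ * X₀ ^ 2 - e₁ * Y₀ ^ 2)))) * hmn +
    (m * e₁ + n * e₂) * l * hQ

/-- `(z₀ X - X₀ z) / (z₀ Y - Y₀ z)` is close to `(z₀ √D₁ - X₀) / (z₀ √D₂ - Y₀)` for solutions of a
pair of Pell equations with `z` large. -/
theorem pell_ratio_approx {s t : ℝ} (hs : 0 < s) (ht : 0 < t) {e₁ e₂ : ℝ} {X₀ Y₀ z₀ : ℝ}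
    (hz₀ : 0 < z₀) (hw : z₀ * t - Y₀ ≠ 0) :
    ∃ c : ℝ, ∀ᶠ z : ℝ in Filter.atTop, ∀ X Y : ℝ, 0 < X → 0 < Y →
      X ^ 2 - s ^ 2 * z ^ 2 = e₁ → Y ^ 2 - t ^ 2 * z ^ 2 = e₂ →
      z₀ * Y - Y₀ * z ≠ 0 ∧
      |(z₀ * s - X₀) / (z₀ * t - Y₀) - (z₀ * X - X₀ * z) / (z₀ * Y - Y₀ * z)| ≤ c / z ^ 2 := by
  have key : ∀ {r e X z : ℝ}, 0 < r → 0 < X → 0 < z → X ^ 2 - r ^ 2 * z ^ 2 = e →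
      |X - r * z| ≤ |e| / r / z := by
    intro r e X z hr hX hz h
    rw [div_div, le_div_iff₀ (mul_pos hr hz), ← h,
      show X ^ 2 - r ^ 2 * z ^ 2 = (X - r * z) * (X + r * z) by ring, abs_mul]
    gcongr
    exact (by linarith : r * z ≤ X + r * z).trans (le_abs_self _)
  set w := z₀ * t - Y₀
  set k₁ := |e₁| / s
  set k₂ := |e₂| / t
  have hwpos : 0 < |w| := abs_pos.2 hw
  set m := z₀ * (|z₀ * s - X₀| * k₂ + |w| * k₁)
  refine ⟨2 * m / |w| ^ 2, ?_⟩
  filter_upwards [Filter.eventually_ge_atTop 1, Filter.eventually_ge_atTop (2 * z₀ * k₂ / |w|)]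
    with z hz1 hz2 X Y hX hY h1 h2
  have hz : 0 < z := by linarith
  have hx := key hs hX hz h1
  have hy := key ht hY hz h2
  set v := z₀ * Y - Y₀ * z
  have hk₂ : 0 ≤ k₂ := by positivity
  have hv : |w| * z / 2 ≤ |v| := by
    have e : w * z = v + (-(z₀ * (Y - t * z))) := by simp only [w, v]; ring
    have h3 : |w| * z ≤ |v| + z₀ * (k₂ / z) := by
      rw [← abs_of_pos hz, ← abs_mul, e, abs_of_pos hz]
      refine (abs_add_le _ _).trans ?_
      rw [abs_neg, abs_mul, abs_of_pos hz₀]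
      gcongr
    have h4 : z₀ * (k₂ / z) ≤ |w| * z / 2 := by
      rw [div_le_iff₀ hwpos] at hz2
      have : k₂ / z ≤ k₂ := div_le_self hk₂ hz1
      nlinarith
    linarith
  have hvpos : 0 < |v| := lt_of_lt_of_le (by positivity) hv
  have hv0 : v ≠ 0 := abs_pos.1 hvpos
  refine ⟨hv0, ?_⟩
  have e : (z₀ * s - X₀) / w - (z₀ * X - X₀ * z) / v =
      z₀ * ((z₀ * s - X₀) * (Y - t * z) - w * (X - s * z)) / (w * v) := by
    rw [div_sub_div _ _ hw hv0]
    congr 1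
    simp only [w, v]
    ring
  have hn : |z₀ * ((z₀ * s - X₀) * (Y - t * z) - w * (X - s * z))| ≤ m / z := by
    rw [abs_mul, abs_of_pos hz₀]
    simp only [m]
    rw [mul_div_assoc, add_div, mul_div_assoc, mul_div_assoc]
    gcongr
    refine (abs_sub _ _).trans ?_
    rw [abs_mul, abs_mul]
    gcongr
  rw [e, abs_div, abs_mul w v]
  calc _ ≤ (m / z) / (|w| * (|w| * z / 2)) := by gcongr
    _ = _ := by field_simp

end Pell

section PellIrrational

variable {s t : ℝ} {D₁ D₂ e₁ e₂ X₀ Y₀ z₀ : ℤ}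

theorem irrational_biquadratic (hs : s ^ 2 = D₁) (ht : t ^ 2 = D₂) (his : Irrational s)
    (hit : Irrational t) (hist : Irrational (s * t)) {a b c d : ℤ} (hb : b ≠ 0) :
    Irrational ((a : ℝ) + b * s + c * t + d * (s * t)) := by
  rintro ⟨r, hr⟩
  have h := biquadratic_coeff_eq_zero hs ht his hit hist (a := a - r) (b := b) (c := c) (d := d)
    (by push_cast; linarith)
  exact hb (by exact_mod_cast h.2.1)

/-- If `s, t, s t` are irrational, then the positive solutions of a pair of Pell equations are
bounded, provided that there is at least one. -/
theorem exists_bound_pell_of_solution (hs : s ^ 2 = D₁) (ht : t ^ 2 = D₂) (hs0 : 0 < s)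
    (ht0 : 0 < t) (his : Irrational s) (hit : Irrational t) (hist : Irrational (s * t))
    (he₁ : e₁ ≠ 0) (he₂ : e₂ ≠ 0) (hE : e₂ * D₁ - e₁ * D₂ ≠ 0)
    (hX₀ : 0 < X₀) (hY₀ : 0 < Y₀) (hz₀ : 0 < z₀)
    (h₁₀ : X₀ ^ 2 - D₁ * z₀ ^ 2 = e₁) (h₂₀ : Y₀ ^ 2 - D₂ * z₀ ^ 2 = e₂) :
    ∃ B : ℤ, ∀ X Y z : ℤ, 0 < X → 0 < Y → 0 < z →
      X ^ 2 - D₁ * z ^ 2 = e₁ → Y ^ 2 - D₂ * z ^ 2 = e₂ → z ≤ B := by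
  have h₁₀' : (X₀ : ℝ) ^ 2 - D₁ * z₀ ^ 2 = e₁ := by exact_mod_cast h₁₀
  have h₂₀' : (Y₀ : ℝ) ^ 2 - D₂ * z₀ ^ 2 = e₂ := by exact_mod_cast h₂₀
  have he₂' : (e₂ : ℝ) ≠ 0 := by exact_mod_cast he₂
  set w : ℝ := z₀ * t - Y₀ with hw
  have hw0 : w ≠ 0 := by
    intro h0
    refine he₂' ?_
    rw [← h₂₀']
    linear_combination (-(z₀ * t + Y₀)) * (hw.symm.trans h0) + (z₀ : ℝ) ^ 2 * ht
  set α : ℝ := (z₀ * s - X₀) / w with hα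
  have hb : -(z₀ * Y₀) ≠ 0 := neg_ne_zero.2 (mul_ne_zero hz₀.ne' hY₀.ne')
  have hc : X₀ * z₀ ≠ 0 := mul_ne_zero hX₀.ne' hz₀.ne'
  set β : ℝ := ((X₀ * Y₀ : ℤ) : ℝ) + (-(z₀ * Y₀) : ℤ) * s + (X₀ * z₀ : ℤ) * t +
    (-z₀ ^ 2 : ℤ) * (s * t) with hβ
  have hαβ : e₂ * α = β := by
    rw [hα, ← mul_div_assoc, div_eq_iff hw0, hβ, hw]
    push_cast
    linear_combination (-(z₀ * s - X₀ : ℝ)) * h₂₀' + (z₀ : ℝ) ^ 2 * (z₀ * s - X₀) * ht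
  have hκ : e₂ * α ^ 2 - e₁ ≠ 0 := by
    intro h0
    have h := biquadratic_coeff_eq_zero hs ht his hit hist
      (a := (X₀ * Y₀) ^ 2 + (z₀ * Y₀) ^ 2 * D₁ + (X₀ * z₀) ^ 2 * D₂ + z₀ ^ 4 * D₁ * D₂ - e₁ * e₂)
      (b := -2 * (X₀ * Y₀ * (z₀ * Y₀)) - 2 * (X₀ * z₀ * z₀ ^ 2 * D₂))
      (c := 2 * (X₀ * Y₀ * (X₀ * z₀)) + 2 * (z₀ * Y₀ * z₀ ^ 2 * D₁))
      (d := -4 * (X₀ * Y₀ * z₀ ^ 2)) (by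
        have h1 : β ^ 2 - e₁ * e₂ = 0 := by rw [← hαβ]; linear_combination e₂ * h0
        rw [hβ] at h1
        push_cast at h1 ⊢
        linear_combination h1 - ((z₀ * Y₀ + z₀ ^ 2 * t) ^ 2 : ℝ) * hs -
          ((X₀ * z₀) ^ 2 + z₀ ^ 4 * D₁ - 2 * X₀ * z₀ ^ 3 * s : ℝ) * ht)
    have h4 : -4 * (X₀ * Y₀ * z₀ ^ 2) = 0 := by exact_mod_cast h.2.2.2
    have : 0 < X₀ * Y₀ * z₀ ^ 2 := by positivity
    omega
  set κ := |e₂ * α ^ 2 - e₁| with hκdef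
  have hκ0 : 0 < κ := abs_pos.2 hκ
  obtain ⟨δ, hδ, hcont⟩ : ∃ δ > 0, ∀ r : ℝ, |α - r| < δ → κ / 2 ≤ |e₂ * r ^ 2 - e₁| := by
    have hc : ContinuousAt (fun r : ℝ => |e₂ * r ^ 2 - e₁|) α := by fun_prop
    obtain ⟨δ, hδ, h⟩ := Metric.eventually_nhds_iff.1
      (hc.eventually (lt_mem_nhds (half_lt_self hκ0)))
    refine ⟨δ, hδ, fun r hr => (h ?_).le⟩
    rwa [Real.dist_eq, abs_sub_comm]
  set R : ℤ := e₁ * e₂ * (e₂ * D₁ - e₁ * D₂) * z₀ ^ 2 with hR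
  have hR0 : R ≠ 0 := mul_ne_zero (mul_ne_zero (mul_ne_zero he₁ he₂) hE) (pow_ne_zero 2 hz₀.ne')
  obtain ⟨c, hcz⟩ := pell_ratio_approx (e₁ := e₁) (e₂ := e₂) (X₀ := X₀) (Y₀ := Y₀) (z₀ := z₀)
    hs0 ht0 (by exact_mod_cast hz₀) hw0
  obtain ⟨B, hB⟩ := exists_bound_of_abs_biquadratic_sub_div_le hs ht his hit hist hb hc
    (a := X₀ * Y₀) (d := -z₀ ^ 2) (|(e₂ : ℝ)| * (|c| * (4 * |(R : ℝ)| / κ) ^ 2))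
  obtain ⟨η, hη, hηB⟩ := (irrational_biquadratic hs ht his hit hist hb
    (a := X₀ * Y₀) (c := X₀ * z₀) (d := -z₀ ^ 2)).exists_pos_le_abs_sub_div B
  have hlim : ∀ C > (0 : ℝ), ∀ᶠ z : ℝ in Filter.atTop, |c| / z ^ 2 < C := fun C hC =>
    (Filter.Tendsto.const_div_atTop (Filter.tendsto_pow_atTop two_ne_zero) _).eventually
      (gt_mem_nhds hC)
  obtain ⟨Z, hZ⟩ := Filter.eventually_atTop.1
    ((hcz.and (hlim δ hδ)).and (hlim (η / |(e₂ : ℝ)|) (div_pos hη (abs_pos.2 he₂'))))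
  refine ⟨⌈Z⌉, fun X Y z hX hY hz h1 h2 => ?_⟩
  by_contra! hlt
  have hz' : (0 : ℝ) < z := by exact_mod_cast hz
  obtain ⟨⟨hz1, hz2⟩, hz3⟩ := hZ z (Int.ceil_le.1 hlt.le)
  obtain ⟨hv, happ⟩ := hz1 X Y (by exact_mod_cast hX) (by exact_mod_cast hY)
    (by rw [hs]; exact_mod_cast h1) (by rw [ht]; exact_mod_cast h2)
  have hv' : z₀ * Y - Y₀ * z ≠ 0 := by exact_mod_cast hv
  obtain ⟨g, hgp, hgq⟩ := Rat.exists_eq_mul_div_num_and_eq_mul_div_den (z₀ * X - X₀ * z) hv'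
  set r : ℚ := ((z₀ * X - X₀ * z : ℤ) : ℚ) / (z₀ * Y - Y₀ * z : ℤ)
  set p : ℤ := r.num
  set q : ℤ := (r.den : ℤ)
  have hq0 : 0 < q := Int.natCast_pos.2 r.pos
  have hq0' : (0 : ℝ) < q := by exact_mod_cast hq0
  have hg0 : g ≠ 0 := fun h0 => hv' (by rw [hgq, h0, zero_mul])
  have hpq : IsCoprime p q := Int.isCoprime_iff_nat_coprime.2 (by simpa [p, q] using r.reduced)
  have hratio : ((z₀ * X - X₀ * z : ℝ) / (z₀ * Y - Y₀ * z)) = p / q := by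
    have h1 : (z₀ * X - X₀ * z : ℝ) = g * p := by exact_mod_cast hgp
    have h2 : (z₀ * Y - Y₀ * z : ℝ) = g * q := by exact_mod_cast hgq
    rw [h1, h2, mul_div_mul_left _ _ (by exact_mod_cast hg0)]
  rw [hratio, ← hw, ← hα] at happ
  replace happ : |α - p / q| ≤ |c| / z ^ 2 := happ.trans (by gcongr; exact le_abs_self c)
  have hdvd := Int.le_of_dvd (by positivity) ((abs_dvd_abs _ _).2
    (pell_dvd_of_isCoprime h₁₀ h₂₀ h1 h2 hg0 hgp hgq hpq))
  have hle : (q : ℝ) ^ 2 * (κ / 2) ≤ 2 * z * |(R : ℝ)| := by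
    have hdvd' : |(e₂ : ℝ) * p ^ 2 - e₁ * q ^ 2| ≤ |2 * z * (R : ℝ)| := by exact_mod_cast hdvd
    calc (q : ℝ) ^ 2 * (κ / 2) ≤ q ^ 2 * |e₂ * (p / q : ℝ) ^ 2 - e₁| := by
          gcongr
          exact hcont _ (happ.trans_lt hz2)
      _ = |(e₂ : ℝ) * p ^ 2 - e₁ * q ^ 2| := by
          rw [← abs_of_pos (pow_pos hq0' 2), ← abs_mul, abs_of_pos (pow_pos hq0' 2)]
          congr 1
          field_simp
      _ ≤ _ := hdvd'
      _ = _ := by rw [abs_mul, abs_of_pos (by positivity)]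
  have hβr : |β - (e₂ * p : ℤ) / q| = |(e₂ : ℝ)| * |α - p / q| := by
    rw [← abs_mul, ← hαβ]
    push_cast
    congr 1
    ring
  have hqB : q ≤ B := by
    refine hB (e₂ * p) q hq0 ?_
    rw [← hβ, hβr, mul_div_assoc]
    refine mul_le_mul_of_nonneg_left (happ.trans ?_) (abs_nonneg _)
    have h3 : 1 / (z : ℝ) ≤ 4 * |(R : ℝ)| / κ / q ^ 2 := by
      rw [div_div, div_le_div_iff₀ hz' (by positivity)]
      linarith
    calc |c| / (z : ℝ) ^ 2 = |c| * (1 / z) ^ 2 := by ring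
      _ ≤ |c| * (4 * |(R : ℝ)| / κ / q ^ 2) ^ 2 := by gcongr
      _ = _ := by ring
  have h5 := hηB (e₂ * p) q hq0 hqB
  rw [← hβ, hβr] at h5
  refine absurd h5 (not_le.2 ?_)
  rw [mul_comm, ← lt_div_iff₀ (abs_pos.2 he₂')]
  exact happ.trans_lt hz3

end PellIrrational

theorem Int.abs_le_sq (n : ℤ) : |n| ≤ n ^ 2 := by
  rw [← sq_abs]
  exact Int.le_self_sq |n|

section PellBound

variable {D D₁ D₂ e e₁ e₂ : ℤ}

theorem abs_le_of_sq_sub_mul_sq_eq (hD : D ≠ 0) (h : D < 0 ∨ IsSquare D) (he : e ≠ 0) {x z : ℤ}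
    (hx : x ^ 2 - D * z ^ 2 = e) : |z| ≤ |e| := by
  rcases h with h | ⟨k, rfl⟩
  · calc |z| ≤ z ^ 2 := Int.abs_le_sq z
      _ ≤ e := by nlinarith [sq_nonneg x, sq_nonneg z]
      _ ≤ |e| := le_abs_self e
  · have hk : k ≠ 0 := left_ne_zero_of_mul hD
    have h1 := Int.le_of_dvd (abs_pos.2 he) ((abs_dvd_abs _ _).2
      (Dvd.intro (x + k * z) (by linarith : (x - k * z) * (x + k * z) = e)))
    have h2 := Int.le_of_dvd (abs_pos.2 he) ((abs_dvd_abs _ _).2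
      (Dvd.intro (x - k * z) (by linarith : (x + k * z) * (x - k * z) = e)))
    have h3 : |2 * (k * z)| ≤ |x + k * z| + |x - k * z| := by
      rw [show 2 * (k * z) = (x + k * z) - (x - k * z) by ring]
      exact abs_sub _ _
    rw [abs_mul, abs_mul, abs_two] at h3
    have h4 : |z| ≤ |k| * |z| := le_mul_of_one_le_left (abs_nonneg z) (Int.one_le_abs hk)
    linarith

theorem abs_le_of_neg_mul_sq_eq (hD : 0 < D) {z : ℤ} (hz : (0 : ℤ) ^ 2 - D * z ^ 2 = e) :
    |z| ≤ |e| :=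
  calc |z| ≤ z ^ 2 := Int.abs_le_sq z
    _ ≤ -e := by nlinarith [sq_nonneg z]
    _ ≤ |e| := neg_le_abs e

theorem exists_bound_pell (hD₁ : D₁ ≠ 0) (hD₂ : D₂ ≠ 0) (he₁ : e₁ ≠ 0) (he₂ : e₂ ≠ 0)
    (hE : e₂ * D₁ - e₁ * D₂ ≠ 0) :
    ∃ B : ℤ, ∀ X Y z : ℤ, X ^ 2 - D₁ * z ^ 2 = e₁ → Y ^ 2 - D₂ * z ^ 2 = e₂ → |z| ≤ B := by
  by_cases hs₁ : D₁ < 0 ∨ IsSquare D₁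
  · exact ⟨|e₁|, fun X Y z h _ => abs_le_of_sq_sub_mul_sq_eq hD₁ hs₁ he₁ h⟩
  by_cases hs₂ : D₂ < 0 ∨ IsSquare D₂
  · exact ⟨|e₂|, fun X Y z _ h => abs_le_of_sq_sub_mul_sq_eq hD₂ hs₂ he₂ h⟩
  rw [not_or, not_lt] at hs₁ hs₂
  have hD₁pos : 0 < D₁ := hs₁.1.lt_of_ne' hD₁
  have hD₂pos : 0 < D₂ := hs₂.1.lt_of_ne' hD₂
  by_cases hs₁₂ : IsSquare (D₁ * D₂)
  · have hf : D₂ * (D₂ * e₁ - D₁ * e₂) ≠ 0 :=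
      mul_ne_zero hD₂ fun h => hE (by linarith)
    refine ⟨(D₂ * (D₂ * e₁ - D₁ * e₂)) ^ 2 + |e₂|, fun X Y z h1 h2 => ?_⟩
    have hY := abs_le_of_sq_sub_mul_sq_eq (mul_ne_zero hD₁ hD₂) (Or.inr hs₁₂) hf
      (x := D₂ * X) (z := Y) (by linear_combination D₂ ^ 2 * h1 - D₁ * D₂ * h2)
    calc |z| ≤ z ^ 2 := Int.abs_le_sq z
      _ ≤ Y ^ 2 - e₂ := by nlinarith [sq_nonneg z]
      _ ≤ _ := by linarith [sq_le_sq.2 hY, neg_abs_le e₂]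
  have small : ∀ {X Y z : ℤ}, X ^ 2 - D₁ * z ^ 2 = e₁ → Y ^ 2 - D₂ * z ^ 2 = e₂ →
      X = 0 ∨ Y = 0 ∨ z = 0 → |z| ≤ |e₁| + |e₂| := by
    rintro X Y z h1 h2 (rfl | rfl | rfl)
    · exact (abs_le_of_neg_mul_sq_eq hD₁pos h1).trans (le_add_of_nonneg_right (abs_nonneg _))
    · exact (abs_le_of_neg_mul_sq_eq hD₂pos h2).trans (le_add_of_nonneg_left (abs_nonneg _))
    · rw [abs_zero]
      positivity
  by_cases hsol : ∃ X₀ Y₀ z₀ : ℤ, (X₀ ^ 2 - D₁ * z₀ ^ 2 = e₁ ∧ Y₀ ^ 2 - D₂ * z₀ ^ 2 = e₂) ∧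
      X₀ ≠ 0 ∧ Y₀ ≠ 0 ∧ z₀ ≠ 0
  · obtain ⟨X₀, Y₀, z₀, ⟨h₁₀, h₂₀⟩, hX₀, hY₀, hz₀⟩ := hsol
    have hD₁' : (0 : ℝ) < D₁ := by exact_mod_cast hD₁pos
    have hD₂' : (0 : ℝ) < D₂ := by exact_mod_cast hD₂pos
    obtain ⟨B, hB⟩ := exists_bound_pell_of_solution (Real.sq_sqrt hD₁'.le) (Real.sq_sqrt hD₂'.le)
      (Real.sqrt_pos.2 hD₁') (Real.sqrt_pos.2 hD₂')
      ((irrational_sqrt_intCast_iff_of_nonneg hs₁.1).2 hs₁.2)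
      ((irrational_sqrt_intCast_iff_of_nonneg hs₂.1).2 hs₂.2)
      (by
        rw [← Real.sqrt_mul hD₁'.le, ← Int.cast_mul]
        exact (irrational_sqrt_intCast_iff_of_nonneg (mul_pos hD₁pos hD₂pos).le).2 hs₁₂)
      he₁ he₂ hE (abs_pos.2 hX₀) (abs_pos.2 hY₀) (abs_pos.2 hz₀)
      (by simpa only [sq_abs] using h₁₀) (by simpa only [sq_abs] using h₂₀)
    refine ⟨max B (|e₁| + |e₂|), fun X Y z h1 h2 => ?_⟩
    by_cases h0 : X = 0 ∨ Y = 0 ∨ z = 0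
    · exact le_max_of_le_right (small h1 h2 h0)
    · simp only [not_or] at h0
      exact le_max_of_le_left (hB |X| |Y| |z| (abs_pos.2 h0.1) (abs_pos.2 h0.2.1)
        (abs_pos.2 h0.2.2) (by simpa only [sq_abs] using h1) (by simpa only [sq_abs] using h2))
  · refine ⟨|e₁| + |e₂|, fun X Y z h1 h2 => small h1 h2 ?_⟩
    by_contra h0
    simp only [not_or] at h0
    exact hsol ⟨X, Y, z, ⟨h1, h2⟩, h0⟩

end PellBound

theorem quadratic_triple_system_finite (a₁ b₁ c₁ d₁ a₂ b₂ c₂ d₂ : ℤ)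
    (h₁ : a₁ * b₂ - a₂ * b₁ ≠ 0) (h₂ : a₁ * c₂ - a₂ * c₁ ≠ 0)
    (h₃ : a₁ * d₂ - a₂ * d₁ ≠ 0) (h₄ : b₁ * c₂ - b₂ * c₁ ≠ 0)
    (h₅ : b₁ * d₂ - b₂ * d₁ ≠ 0) (h₆ : c₁ * d₂ - c₂ * d₁ ≠ 0) :
    {t : ℤ × ℤ × ℤ | a₁ * t.1 ^ 2 + b₁ * t.2.1 ^ 2 + c₁ * t.2.2 ^ 2 = d₁ ∧
      a₂ * t.1 ^ 2 + b₂ * t.2.1 ^ 2 + c₂ * t.2.2 ^ 2 = d₂}.Finite := by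
  set r := a₁ * b₂ - a₂ * b₁
  set k := b₁ * c₂ - b₂ * c₁
  set l := b₁ * d₂ - b₂ * d₁
  set m := a₁ * c₂ - a₂ * c₁
  set n := a₁ * d₂ - a₂ * d₁
  obtain ⟨B, hB⟩ := exists_bound_pell (D₁ := r * k) (D₂ := -(r * m)) (e₁ := -(r * l))
    (e₂ := r * n) (mul_ne_zero h₁ h₄) (neg_ne_zero.2 (mul_ne_zero h₁ h₂))
    (neg_ne_zero.2 (mul_ne_zero h₁ h₅)) (mul_ne_zero h₁ h₃) (by
      have : r * n * (r * k) - -(r * l) * -(r * m) = - r ^ 3 * (c₁ * d₂ - c₂ * d₁) := by ring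
      rw [this]
      exact mul_ne_zero (neg_ne_zero.2 (pow_ne_zero 3 h₁)) h₆)
  have bound : ∀ {f g x z : ℤ}, r * x ^ 2 = f * z ^ 2 + g → |z| ≤ B → |x| ≤ |f| * B ^ 2 + |g| := by
    intro f g x z h hz
    calc |x| ≤ x ^ 2 := Int.abs_le_sq x
      _ ≤ |r| * x ^ 2 := le_mul_of_one_le_left (sq_nonneg x) (Int.one_le_abs h₁)
      _ = |f * z ^ 2 + g| := by rw [← h, abs_mul, abs_of_nonneg (sq_nonneg x)]
      _ ≤ |f| * z ^ 2 + |g| := by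
        refine (abs_add_le _ _).trans_eq ?_
        rw [abs_mul, abs_of_nonneg (sq_nonneg z)]
      _ ≤ _ := by
        gcongr 1
        exact mul_le_mul_of_nonneg_left (sq_le_sq.2 (hz.trans (le_abs_self B))) (abs_nonneg f)
  refine ((Set.finite_Icc (-(|k| * B ^ 2 + |-l|)) (|k| * B ^ 2 + |-l|)).prod
    ((Set.finite_Icc (-(|-m| * B ^ 2 + |n|)) (|-m| * B ^ 2 + |n|)).prod
      (Set.finite_Icc (-B) B))).subset ?_
  rintro ⟨x, y, z⟩ ⟨hx, hy⟩
  dsimp only at hx hy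
  have hxz : r * x ^ 2 = k * z ^ 2 + -l := by linear_combination b₂ * hx - b₁ * hy
  have hyz : r * y ^ 2 = -m * z ^ 2 + n := by linear_combination a₁ * hy - a₂ * hx
  have hz : |z| ≤ B := hB (r * x) (r * y) z (by linear_combination r * hxz)
    (by linear_combination r * hyz)
  exact ⟨abs_le.1 (bound hxz hz), abs_le.1 (bound hyz hz), abs_le.1 hz⟩
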